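/- Let (Γ; ≤₁, …, ≤ₙ) be a homogeneous n-dimensional permutation structure. Then the lattice of ∅-definable equivalence relations on Γ is distributive: for all ∅-definable equivalence relations E, F, G on Γ, E ⊓ (F ⊔ G) = (E ⊓ F) ⊔ (E ⊓ G), where ⊓ is intersection and ⊔ is the join of equivalence relations (transitive closure of the union). -/

import Mathlib

/-- An `n`-dimensional permutation structure: a set `Γ` equipped with `n` linear orders. -/
structure PermStruct (n : ℕ) (Γ : Type*) where
  le : Fin n → Γ → Γ → Prop
  total : ∀ i x y, le i x y ∨ le i y x
  antisymm : ∀ i x y, le i x y → le i y x → x = y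
  trans : ∀ i x y z, le i x y → le i y z → le i x z

namespace PermStruct

variable {n : ℕ} {Γ : Type*} (S : PermStruct n Γ)

/-- An automorphism of the permutation structure: a bijection of `Γ` preserving each order. -/
def IsAuto (σ : Γ ≃ Γ) : Prop :=
  ∀ i x y, S.le i x y ↔ S.le i (σ x) (σ y)

/-- Homogeneity: every isomorphism between finite substructures (i.e. every bijection between
finite subsets preserving each order) extends to an automorphism. -/
def Homogeneous : Prop :=
  ∀ (A : Finset Γ) (f : Γ → Γ), Set.InjOn f A →
    (∀ i, ∀ x ∈ A, ∀ y ∈ A, (S.le i x y ↔ S.le i (f x) (f y))) →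
    ∃ σ : Γ ≃ Γ, S.IsAuto σ ∧ ∀ a ∈ A, σ a = f a

/-- A binary relation is ∅-definable iff it is invariant under all automorphisms. -/
def Definable (R : Γ → Γ → Prop) : Prop :=
  ∀ σ : Γ ≃ Γ, S.IsAuto σ → ∀ x y, R x y ↔ R (σ x) (σ y)

/-- `E` is `≤ᵢ`-convex: every `E`-class is an interval with respect to `≤ᵢ`. -/
def Convex (i : Fin n) (E : Γ → Γ → Prop) : Prop :=
  ∀ x y z, S.le i x y → S.le i y z → E x z → E x y

end PermStruct

namespace PermStruct

variable {n : ℕ} {Γ : Type*} {S : PermStruct n Γ}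

theorem le_refl (S : PermStruct n Γ) (i : Fin n) (x : Γ) : S.le i x x :=
  (S.total i x x).elim id id

theorem le_swap_iff {x y : Γ} (hxy : x ≠ y) (i : Fin n) : S.le i y x ↔ ¬ S.le i x y :=
  ⟨fun h h' => hxy (S.antisymm i x y h' h), fun h => (S.total i x y).resolve_left h⟩

/-- Each realized sign vector defines a transitive relation. -/
theorem sameOrder_trans [Nonempty (Fin n)] {t : Fin n → Prop} {x y z : Γ}
    (hxy : x ≠ y) (hyz : y ≠ z) (h₁ : ∀ i, S.le i x y ↔ t i) (h₂ : ∀ i, S.le i y z ↔ t i) :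
    x ≠ z ∧ ∀ i, S.le i x z ↔ t i := by
  have hxz : x ≠ z := by
    rintro rfl
    obtain ⟨i⟩ := ‹Nonempty (Fin n)›
    have := le_swap_iff (S := S) hxy i
    rw [h₁, h₂] at this
    tauto
  refine ⟨hxz, fun i => ?_⟩
  by_cases ht : t i
  · exact iff_of_true (S.trans i _ _ _ ((h₁ i).2 ht) ((h₂ i).2 ht)) ht
  · refine iff_of_false ((le_swap_iff hxz i).1 (S.trans i _ y _ ?_ ?_)) ht
    · exact (le_swap_iff hyz i).2 (mt (h₂ i).1 ht)
    · exact (le_swap_iff hxy i).2 (mt (h₁ i).1 ht)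

/-- By homogeneity, a definable relation depends only on the sign vector of a pair. -/
theorem Homogeneous.definable_iff (hhom : S.Homogeneous) {R : Γ → Γ → Prop} (hR : S.Definable R)
    {x y x' y' : Γ} (hxy : x ≠ y) (hxy' : x' ≠ y') (h : ∀ i, S.le i x y ↔ S.le i x' y') :
    R x y ↔ R x' y' := by
  classical
  obtain ⟨σ, hσ, hA⟩ := hhom {x, y} (fun u => if u = x then x' else y')
    (by
      intro a ha b hb hab
      simp only [Finset.coe_insert, Finset.coe_singleton, Set.mem_insert_iff,
        Set.mem_singleton_iff] at ha hb
      rcases ha with rfl | rfl <;> rcases hb with rfl | rfl <;> simp_all [eq_comm])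
    (by
      intro i a ha b hb
      simp only [Finset.mem_insert, Finset.mem_singleton] at ha hb
      rcases ha with rfl | rfl <;> rcases hb with rfl | rfl
      · simp [le_refl]
      · simpa [hxy.symm] using h i
      · simp only [hxy.symm, if_true, if_false]
        rw [le_swap_iff hxy, le_swap_iff hxy', h]
      · simp [le_refl])
  have h₁ : σ x = x' := by simpa using hA x (by simp)
  have h₂ : σ y = y' := by simpa [hxy.symm] using hA y (by simp)
  rw [hR σ hσ, h₁, h₂]

theorem Homogeneous.exists_auto_apply_eq (hhom : S.Homogeneous) (x y : Γ) :
    ∃ σ : Γ ≃ Γ, S.IsAuto σ ∧ σ x = y := by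
  obtain ⟨σ, hσ, h⟩ := hhom {x} (fun _ => y) (by simp) (by simp [le_refl])
  exact ⟨σ, hσ, h x (by simp)⟩

/-- Every realized sign vector is realized by all increasing pairs of an infinite sequence. -/
theorem Homogeneous.exists_chain [Nonempty (Fin n)] (hhom : S.Homogeneous) {x z : Γ}
    (hxz : x ≠ z) : ∃ X : ℕ → Γ, X 0 = x ∧
      ∀ j k, j < k → X j ≠ X k ∧ ∀ i, S.le i (X j) (X k) ↔ S.le i x z := by
  obtain ⟨σ, hσ, rfl⟩ := hhom.exists_auto_apply_eq x z
  refine ⟨fun k => σ^[k] x, rfl, fun j k hjk => ?_⟩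
  have step : ∀ k, σ^[k] x ≠ σ^[k + 1] x ∧
      ∀ i, S.le i (σ^[k] x) (σ^[k + 1] x) ↔ S.le i x (σ x) := by
    intro k
    induction k with
    | zero => exact ⟨hxz, fun i => Iff.rfl⟩
    | succ k ih =>
      simp only [Function.iterate_succ_apply'] at ih ⊢
      exact ⟨fun h => ih.1 (σ.injective h), fun i => (hσ i _ _).symm.trans (ih.2 i)⟩
  induction k, hjk using Nat.le_induction with
  | base => exact step j
  | succ k _ ih => exact sameOrder_trans ih.1 (step k).1 ih.2 (step k).2

theorem Definable.comp {R T : Γ → Γ → Prop} (hR : S.Definable R) (hT : S.Definable T) :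
    S.Definable (fun x y => ∃ w, R x w ∧ T w y) := by
  intro σ hσ x y
  constructor
  · rintro ⟨w, h₁, h₂⟩
    exact ⟨σ w, (hR σ hσ _ _).1 h₁, (hT σ hσ _ _).1 h₂⟩
  · rintro ⟨w, h₁, h₂⟩
    exact ⟨σ.symm w, (hR σ hσ _ _).2 (by simpa using h₁), (hT σ hσ _ _).2 (by simpa using h₂)⟩

/-- Without orders, the only definable equivalence relations are equality and the full relation. -/
theorem Homogeneous.definable_of_isEmpty [IsEmpty (Fin n)] (hhom : S.Homogeneous) {E : Setoid Γ}
    (hE : S.Definable E) {x y : Γ} (hxy : x ≠ y) (h : E x y) (u v : Γ) : E u v := by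
  by_cases huv : u = v
  · exact huv ▸ E.refl' u
  · exact (hhom.definable_iff hE hxy huv isEmptyElim).1 h

open Filter in
/-- Colourings of increasing quadruples by finitely many predicates are constant on some
pattern of two crossing pairs. -/
theorem exists_crossing_pattern {ι : Type*} [Finite ι] (c : ι → ℕ → ℕ → ℕ → ℕ → Prop) :
    ∃ a b c' d e f : ℕ, a < b ∧ b < c' ∧ c' < d ∧ d < e ∧ e < f ∧
      ∀ i, c i a b c' e ↔ c i b d e f := by
  have gt : ∀ a : ℕ, ∀ᶠ b in hyperfilter ℕ, a < b := fun a =>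
    Nat.hyperfilter_le_atTop (eventually_gt_atTop a)
  obtain ⟨t, ht⟩ : ∃ t : ι → Prop, ∀ᶠ a in hyperfilter ℕ, ∀ᶠ b in hyperfilter ℕ,
      ∀ᶠ c' in hyperfilter ℕ, ∀ᶠ d in hyperfilter ℕ, ∀ i, c i a b c' d ↔ t i := by
    refine ⟨fun i => ∀ᶠ a in hyperfilter ℕ, ∀ᶠ b in hyperfilter ℕ,
      ∀ᶠ c' in hyperfilter ℕ, ∀ᶠ d in hyperfilter ℕ, c i a b c' d, ?_⟩
    simp only [eventually_all]
    intro i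
    set p : Prop := ∀ᶠ a in hyperfilter ℕ, ∀ᶠ b in hyperfilter ℕ,
      ∀ᶠ c' in hyperfilter ℕ, ∀ᶠ d in hyperfilter ℕ, c i a b c' d with hp
    by_cases h : p
    · simpa [h] using hp ▸ h
    · simp only [h, iff_false, Ultrafilter.eventually_not]
      exact h
  obtain ⟨a, ha⟩ := ht.exists
  obtain ⟨b, ⟨hb, hb'⟩, hab⟩ := ((ha.and ht).and (gt a)).exists
  obtain ⟨c', hc, hbc⟩ := (hb.and (gt b)).exists
  obtain ⟨d, hd, hcd⟩ := (hb'.and (gt c')).exists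
  obtain ⟨e, ⟨he, he'⟩, hde⟩ := ((hc.and hd).and (gt d)).exists
  obtain ⟨f, hf, hef⟩ := (he'.and (gt e)).exists
  exact ⟨a, b, c', d, e, f, hab, hbc, hcd, hde, hef, fun i => (he i).trans (hf i).symm⟩

/-- Definable equivalence relations commute. -/
theorem Homogeneous.comp_comm (hhom : S.Homogeneous) {E F : Setoid Γ}
    (hE : S.Definable E) (hF : S.Definable F) {x y z : Γ} (hxy : E x y) (hyz : F y z) :
    ∃ w, F x w ∧ E w z := by
  rcases isEmpty_or_nonempty (Fin n) with hn | hn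
  · by_cases h : x = y
    · subst h
      exact ⟨z, hyz, E.refl' z⟩
    · exact ⟨x, F.refl' x, hhom.definable_of_isEmpty hE h hxy x z⟩
  by_contra hcon
  have hxz : x ≠ z := by
    rintro rfl
    exact hcon ⟨x, F.refl' x, E.refl' x⟩
  obtain ⟨X, -, hX⟩ := hhom.exists_chain (S := S) hxz
  have hEF : ∀ j k, j < k → ∃ w, E (X j) w ∧ F w (X k) := fun j k hjk =>
    (hhom.definable_iff (hE.comp hF) (hX j k hjk).1 hxz (hX j k hjk).2).2 ⟨y, hxy, hyz⟩
  have hFE : ∀ j k, j < k → ¬ ∃ w, F (X j) w ∧ E w (X k) := fun j k hjk h =>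
    hcon ((hhom.definable_iff (hF.comp hE) (hX j k hjk).1 hxz (hX j k hjk).2).1 h)
  have : Nonempty Γ := ⟨x⟩
  choose! Y hXY hYX using hEF
  obtain ⟨a, b, c, d, e, f, hab, hbc, hcd, hde, hef, hcol⟩ :=
    exists_crossing_pattern (fun i a b c d => S.le i (Y a c) (Y b d))
  have ne : ∀ {a b c d}, a < b → a < c → b < d → Y a c ≠ Y b d := fun {a b c d} hab hac hbd h =>
    hFE a b hab ⟨X a, F.refl' _, E.trans' (hXY a c hac) (h ▸ E.symm' (hXY b d hbd))⟩
  have h₁ : Y a c ≠ Y b e := ne hab (by omega) (by omega)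
  have h₂ : Y b e ≠ Y d f := ne (by omega) (by omega) (by omega)
  obtain ⟨h₃, h₄⟩ := sameOrder_trans (S := S) h₁ h₂ (fun i => Iff.rfl) (fun i => (hcol i).symm)
  obtain ⟨w, hw₁, hw₂⟩ := (hhom.definable_iff (hF.comp hE) h₃ h₁ h₄).2
    ⟨Y b c, F.trans' (hYX a c (by omega)) (F.symm' (hYX b c hbc)),
      E.trans' (E.symm' (hXY b c hbc)) (hXY b e (by omega))⟩
  exact hFE c d hcd ⟨w, F.trans' (F.symm' (hYX a c (by omega))) hw₁,
    E.trans' hw₂ (E.symm' (hXY d f (by omega)))⟩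

theorem Homogeneous.sup_iff (hhom : S.Homogeneous) {E F : Setoid Γ}
    (hE : S.Definable E) (hF : S.Definable F) {x y : Γ} :
    (E ⊔ F) x y ↔ ∃ w, E x w ∧ F w y := by
  constructor
  · intro h
    rw [Setoid.sup_eq_eqvGen] at h
    have h' : Relation.EqvGen (fun x y => E x y ∨ F x y) x y := h
    clear h
    induction h' with
    | rel x y h =>
      rcases h with h | h
      · exact ⟨y, h, F.refl' y⟩
      · exact ⟨x, E.refl' x, h⟩
    | refl x => exact ⟨x, E.refl' x, F.refl' x⟩
    | symm x y _ ih =>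
      obtain ⟨w, h₁, h₂⟩ := ih
      exact hhom.comp_comm hF hE (F.symm' h₂) (E.symm' h₁)
    | trans x y z _ _ ih₁ ih₂ =>
      obtain ⟨u, h₁, h₂⟩ := ih₁
      obtain ⟨v, h₃, h₄⟩ := ih₂
      obtain ⟨w, h₅, h₆⟩ := hhom.comp_comm hF hE h₂ h₃
      exact ⟨w, E.trans' h₁ h₅, F.trans' h₆ h₄⟩
  · rintro ⟨w, h₁, h₂⟩
    exact (E ⊔ F).trans' (Setoid.le_def.1 le_sup_left h₁) (Setoid.le_def.1 le_sup_right h₂)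

theorem Definable.inf {E F : Setoid Γ} (hE : S.Definable E) (hF : S.Definable F) :
    S.Definable (E ⊓ F : Setoid Γ) := fun σ hσ x y =>
  and_congr (hE σ hσ x y) (hF σ hσ x y)

theorem Homogeneous.definable_sup (hhom : S.Homogeneous) {E F : Setoid Γ}
    (hE : S.Definable E) (hF : S.Definable F) : S.Definable (E ⊔ F : Setoid Γ) := by
  intro σ hσ x y
  exact (hhom.sup_iff hE hF).trans ((hE.comp hF σ hσ x y).trans (hhom.sup_iff hE hF).symm)

/-- The lattice of definable equivalence relations is modular. -/
theorem Homogeneous.sup_inf_le (hhom : S.Homogeneous) {D E F : Setoid Γ}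
    (hD : S.Definable D) (hE : S.Definable E) (hF : S.Definable F) (hDF : D ≤ F) :
    (D ⊔ E) ⊓ F ≤ D ⊔ (E ⊓ F) := by
  rw [Setoid.le_def]
  rintro x y ⟨h, hxy⟩
  obtain ⟨w, h₁, h₂⟩ := (hhom.sup_iff hD hE).1 h
  exact (hhom.sup_iff hD (hE.inf hF)).2
    ⟨w, h₁, h₂, F.trans' (F.symm' (Setoid.le_def.1 hDF h₁)) hxy⟩

/-- Points over a finite set `A` that lie in pairwise different `Aut(Γ/A)`-orbits are
polynomially many in the size of `A`. -/
theorem Homogeneous.card_le_of_orbits [Nonempty (Fin n)] (hhom : S.Homogeneous) (A D : Finset Γ)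
    (hD : ∀ d ∈ D, ∀ d' ∈ D, d ≠ d' →
      ¬ ∃ σ : Γ ≃ Γ, S.IsAuto σ ∧ (∀ a ∈ A, σ a = a) ∧ σ d = d') :
    D.card ≤ ((A.card + 1) * (A.card + 1)) ^ n := by
  classical
  let lower (i : Fin n) (d : Γ) : Finset Γ := A.filter fun a => S.le i a d
  let upper (i : Fin n) (d : Γ) : Finset Γ := A.filter fun a => S.le i d a
  let φ (d : Γ) : Fin n → Fin (A.card + 1) × Fin (A.card + 1) := fun i =>
    (⟨(lower i d).card, Nat.lt_succ_of_le (Finset.card_filter_le _ _)⟩,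
      ⟨(upper i d).card, Nat.lt_succ_of_le (Finset.card_filter_le _ _)⟩)
  have hφ : Set.InjOn φ D := by
    intro d hd d' hd' h
    by_contra hne
    have hl : ∀ i, lower i d = lower i d' := by
      intro i
      have hc : (lower i d).card = (lower i d').card := by
        simpa [φ] using congrArg (fun g => ((g i).1 : ℕ)) h
      rcases S.total i d d' with hle | hle
      · exact Finset.eq_of_subset_of_card_le
          (Finset.monotone_filter_right _ fun a _ ha => S.trans i _ _ _ ha hle) hc.ge
      · exact (Finset.eq_of_subset_of_card_le
          (Finset.monotone_filter_right _ fun a _ ha => S.trans i _ _ _ ha hle) hc.le).symm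
    have hu : ∀ i, upper i d = upper i d' := by
      intro i
      have hc : (upper i d).card = (upper i d').card := by
        simpa [φ] using congrArg (fun g => ((g i).2 : ℕ)) h
      rcases S.total i d d' with hle | hle
      · exact (Finset.eq_of_subset_of_card_le
          (Finset.monotone_filter_right _ fun a _ ha => S.trans i _ _ _ hle ha) hc.le).symm
      · exact Finset.eq_of_subset_of_card_le
          (Finset.monotone_filter_right _ fun a _ ha => S.trans i _ _ _ hle ha) hc.ge
    have hl' : ∀ i, ∀ a ∈ A, (S.le i a d ↔ S.le i a d') := fun i a ha => by
      simpa [lower, ha] using Finset.ext_iff.1 (hl i) a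
    have hu' : ∀ i, ∀ a ∈ A, (S.le i d a ↔ S.le i d' a) := fun i a ha => by
      simpa [upper, ha] using Finset.ext_iff.1 (hu i) a
    obtain ⟨i₀⟩ := ‹Nonempty (Fin n)›
    have hdA : d ∉ A := fun hA => hne <|
      S.antisymm i₀ _ _ ((hl' i₀ d hA).1 (S.le_refl _ _)) ((hu' i₀ d hA).1 (S.le_refl _ _))
    have hdA' : d' ∉ A := fun hA => hne <|
      S.antisymm i₀ _ _ ((hu' i₀ d' hA).2 (S.le_refl _ _)) ((hl' i₀ d' hA).2 (S.le_refl _ _))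
    have hid : ∀ a ∈ A, (if a = d then d' else a) = a := fun a ha =>
      if_neg (by rintro rfl; exact hdA ha)
    obtain ⟨σ, hσ, hσA⟩ := hhom (insert d A) (fun u => if u = d then d' else u)
      (by
        intro a ha b hb hab
        simp only [Finset.coe_insert, Set.mem_insert_iff, Finset.mem_coe] at ha hb
        rcases ha with rfl | ha <;> rcases hb with rfl | hb
        · rfl
        · simp only [if_true, hid b hb] at hab
          exact (hdA' (hab ▸ hb)).elim
        · simp only [if_true, hid a ha] at hab
          exact (hdA' (hab ▸ ha)).elim
        · simpa only [hid a ha, hid b hb] using hab)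
      (by
        intro i a ha b hb
        rw [Finset.mem_insert] at ha hb
        rcases ha with rfl | ha <;> rcases hb with rfl | hb
        · simp [le_refl]
        · simpa only [if_true, hid b hb] using hu' i b hb
        · simpa only [if_true, hid a ha] using hl' i a ha
        · simp only [hid a ha, hid b hb])
    refine hD d hd d' hd' hne ⟨σ, hσ, fun a ha => ?_, ?_⟩
    · exact (hσA a (Finset.mem_insert_of_mem ha)).trans (hid a ha)
    · exact (hσA d (Finset.mem_insert_self _ _)).trans (if_pos rfl)
  calc D.card ≤ (Finset.univ : Finset (Fin n → Fin (A.card + 1) × Fin (A.card + 1))).card :=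
        Finset.card_le_card_of_injOn φ (fun _ _ => Finset.mem_univ _) hφ
    _ = ((A.card + 1) * (A.card + 1)) ^ n := by simp

theorem exists_pow_lt_two_pow (n : ℕ) : ∃ m : ℕ, ((m + 2) * (m + 2)) ^ n < 2 ^ m := by
  have h := tendsto_pow_const_div_const_pow_of_one_lt (2 * n) (r := (2 : ℝ)) (by norm_num)
  have h' := (h.eventually (gt_mem_nhds (show (0 : ℝ) < 1 / 4 by norm_num))).and
    (Filter.eventually_ge_atTop 2)
  obtain ⟨k, hk, hk2⟩ := h'.exists
  obtain ⟨m, rfl⟩ := Nat.exists_eq_add_of_le' hk2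
  refine ⟨m, ?_⟩
  rw [div_lt_iff₀ (by positivity), pow_mul, pow_add 2 m 2] at hk
  have : (((m : ℝ) + 2) * (m + 2)) ^ n < 2 ^ m := by
    push_cast at hk
    rw [← sq]
    linarith
  exact_mod_cast this

section Diamond

variable {E F G H : Setoid Γ}

/-- Translating in the `E`-class of `o` doubles a family of `H`-classes at the cost of one
parameter. -/
theorem Homogeneous.exists_doubling (hhom : S.Homogeneous)
    (hE : S.Definable E) (hF : S.Definable F) (hG : S.Definable G)
    (hEF : E ⊓ F = H) (hEG : E ⊓ G = H) (hFG : F ⊓ G = H)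
    (hle : ∀ x y, E x y → ∃ w, F x w ∧ G w y)
    {X : ℕ → Γ} (hXE : ∀ j, E (X 0) (X j)) (hXH : ∀ j k, H (X j) (X k) → j = k) (m : ℕ) :
    ∃ A D : Finset Γ, A.card ≤ m + 1 ∧ X 0 ∈ A ∧ D.card = 2 ^ m ∧ (∀ d ∈ D, E (X 0) d) ∧
      (∀ d ∈ D, ∀ d' ∈ D, H d d' → d = d') ∧
      ∀ σ : Γ ≃ Γ, S.IsAuto σ → (∀ a ∈ A, σ a = a) → ∀ d ∈ D, H d (σ d) := by
  classical
  have mkEF : ∀ {x y}, E x y → F x y → H x y := fun h₁ h₂ => hEF ▸ ⟨h₁, h₂⟩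
  have mkEG : ∀ {x y}, E x y → G x y → H x y := fun h₁ h₂ => hEG ▸ ⟨h₁, h₂⟩
  have mkFG : ∀ {x y}, F x y → G x y → H x y := fun h₁ h₂ => hFG ▸ ⟨h₁, h₂⟩
  have toE : ∀ {x y}, H x y → E x y := fun h => (hEF.symm ▸ h : (E ⊓ F) _ _).1
  have toF : ∀ {x y}, H x y → F x y := fun h => (hEF.symm ▸ h : (E ⊓ F) _ _).2
  have toG : ∀ {x y}, H x y → G x y := fun h => (hEG.symm ▸ h : (E ⊓ G) _ _).2
  induction m with
  | zero =>
    refine ⟨{X 0}, {X 0}, by simp, by simp, by simp, by simp, by simp, ?_⟩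
    intro σ _ hA d hd
    rw [hA d hd]
  | succ m ih =>
    obtain ⟨A, D, hA, hoA, hDc, hDE, hDH, hdef⟩ := ih
    set o := X 0
    let bad (d d' : Γ) : Set ℕ :=
      {k | ∃ x w, F d x ∧ E x w ∧ G x d' ∧ F o w ∧ G w (X k)}
    have hbad : ∀ d d', (bad d d').Subsingleton := by
      rintro d d' k ⟨x, w, h₁, h₂, h₃, h₄, h₅⟩ k' ⟨x', w', h₁', h₂', h₃', h₄', h₅'⟩
      have hx : H x x' := mkFG (F.trans' (F.symm' h₁) h₁') (G.trans' h₃ (G.symm' h₃'))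
      have hw : H w w' := mkEF (E.trans' (E.symm' h₂) (E.trans' (toE hx) h₂'))
        (F.trans' (F.symm' h₄) h₄')
      exact hXH k k' (mkEG (E.trans' (E.symm' (hXE k)) (hXE k'))
        (G.trans' (G.symm' h₅) (G.trans' (toG hw) h₅')))
    have hfin : (⋃ d ∈ D, ⋃ d' ∈ D, bad d d').Finite :=
      D.finite_toSet.biUnion fun d _ => D.finite_toSet.biUnion fun d' _ => (hbad d d').finite
    obtain ⟨k, hk⟩ := hfin.exists_notMem
    simp only [Set.mem_iUnion, not_exists] at hk
    obtain ⟨w, how, hwk⟩ := hle o (X k) (hXE k)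
    have hτ : ∀ d, E o d → ∃ x v, F d x ∧ E x w ∧ G x v ∧ E v (X k) := by
      intro d hd
      obtain ⟨x, h₁, h₂⟩ := hhom.comp_comm hE hF (E.symm' hd) how
      obtain ⟨v, h₃, h₄⟩ := hhom.comp_comm hE hG h₂ hwk
      exact ⟨x, v, h₁, h₂, h₃, h₄⟩
    choose! ξ τ hξF hξE hξG hτE using hτ
    have hτo : ∀ d, E o d → E o (τ d) := fun d hd =>
      E.trans' (hXE k) (E.symm' (hτE d hd))
    have hτH : ∀ d ∈ D, ∀ d' ∈ D, H (τ d) (τ d') → d = d' := by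
      intro d hd d' hd' h
      have h₁ := hDE d hd
      have h₂ := hDE d' hd'
      have hx : H (ξ d) (ξ d') := mkEG (E.trans' (hξE d h₁) (E.symm' (hξE d' h₂)))
        (G.trans' (hξG d h₁) (G.trans' (toG h) (G.symm' (hξG d' h₂))))
      exact hDH d hd d' hd' (mkEF (E.trans' (E.symm' h₁) h₂)
        (F.trans' (hξF d h₁) (F.trans' (toF hx) (F.symm' (hξF d' h₂)))))
    have hτD : ∀ d ∈ D, ∀ d' ∈ D, ¬ H (τ d) d' := fun d hd d' hd' h =>
      hk d hd d' hd' ⟨ξ d, w, hξF d (hDE d hd), hξE d (hDE d hd),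
        G.trans' (hξG d (hDE d hd)) (toG h), how, hwk⟩
    have hdisj : Disjoint D (D.image τ) := by
      rw [Finset.disjoint_right]
      intro v hv hv'
      obtain ⟨d, hd, rfl⟩ := Finset.mem_image.1 hv
      exact hτD d hd _ hv' (H.refl' _)
    refine ⟨insert w A, D ∪ D.image τ, ?_, Finset.mem_insert_of_mem hoA, ?_, ?_, ?_, ?_⟩
    · exact (Finset.card_insert_le _ _).trans (by omega)
    · rw [Finset.card_union_of_disjoint hdisj, Finset.card_image_of_injOn, hDc]
      · ring
      · intro d hd d' hd' h
        exact hτH d hd d' hd' (h ▸ H.refl' _)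
    · intro v hv
      rcases Finset.mem_union.1 hv with hv | hv
      · exact hDE v hv
      · obtain ⟨d, hd, rfl⟩ := Finset.mem_image.1 hv
        exact hτo d (hDE d hd)
    · intro v hv v' hv' h
      rcases Finset.mem_union.1 hv with hv | hv <;> rcases Finset.mem_union.1 hv' with hv' | hv'
      · exact hDH v hv v' hv' h
      · obtain ⟨d, hd, rfl⟩ := Finset.mem_image.1 hv'
        exact (hτD d hd v hv (H.symm' h)).elim
      · obtain ⟨d, hd, rfl⟩ := Finset.mem_image.1 hv
        exact (hτD d hd v' hv' h).elim
      · obtain ⟨d, hd, rfl⟩ := Finset.mem_image.1 hv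
        obtain ⟨d', hd', rfl⟩ := Finset.mem_image.1 hv'
        rw [hτH d hd d' hd' h]
    · intro σ hσ hσA v hv
      have hσA' : ∀ a ∈ A, σ a = a := fun a ha => hσA a (Finset.mem_insert_of_mem ha)
      rcases Finset.mem_union.1 hv with hv | hv
      · exact hdef σ hσ hσA' v hv
      · obtain ⟨d, hd, rfl⟩ := Finset.mem_image.1 hv
        have hd₀ := hDE d hd
        have hdσ := hdef σ hσ hσA' d hd
        have hw : σ w = w := hσA w (Finset.mem_insert_self _ _)
        have h₁ : F (σ d) (σ (ξ d)) := (hF σ hσ _ _).1 (hξF d hd₀)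
        have h₂ : E (σ (ξ d)) w := hw ▸ (hE σ hσ _ _).1 (hξE d hd₀)
        have h₃ : G (σ (ξ d)) (σ (τ d)) := (hG σ hσ _ _).1 (hξG d hd₀)
        have h₄ : E o (σ (τ d)) := by
          have := (hE σ hσ _ _).1 (hτo d hd₀)
          rwa [hσA' o hoA] at this
        have hx : H (ξ d) (σ (ξ d)) := mkEF (E.trans' (hξE d hd₀) (E.symm' h₂))
          (F.trans' (F.symm' (hξF d hd₀)) (F.trans' (toF hdσ) h₁))
        exact mkEG (E.trans' (E.symm' (hτo d hd₀)) h₄)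
          (G.trans' (G.symm' (hξG d hd₀)) (G.trans' (toG hx) h₃))

/-- The lattice of definable equivalence relations contains no diamond. -/
theorem Homogeneous.le_of_diamond (hhom : S.Homogeneous)
    (hE : S.Definable E) (hF : S.Definable F) (hG : S.Definable G)
    (hEF : E ⊓ F = H) (hEG : E ⊓ G = H) (hFG : F ⊓ G = H) (hle : E ≤ F ⊔ G) : E ≤ H := by
  rw [Setoid.le_def] at hle ⊢
  intro x z hxz
  by_contra hH
  have hne : x ≠ z := fun h => hH (h ▸ H.refl' x)
  have hle' : ∀ x y, E x y → ∃ w, F x w ∧ G w y := fun x y h => (hhom.sup_iff hF hG).1 (hle h)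
  rcases isEmpty_or_nonempty (Fin n) with hn | hn
  · obtain ⟨w, h₁, h₂⟩ := hle' x z hxz
    by_cases h : x = w
    · exact hH (hEG ▸ ⟨hxz, h ▸ h₂⟩)
    · exact hH (hEF ▸ ⟨hxz, hhom.definable_of_isEmpty hF h h₁ x z⟩)
  obtain ⟨X, -, hX⟩ := hhom.exists_chain (S := S) hne
  have hHdef : S.Definable H := hEF ▸ hE.inf hF
  have hXE : ∀ j, E (X 0) (X j) := by
    intro j
    rcases Nat.eq_zero_or_pos j with rfl | hj
    · exact E.refl' _
    · exact (hhom.definable_iff hE (hX 0 j hj).1 hne (hX 0 j hj).2).2 hxz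
  have hXH' : ∀ j k, j < k → ¬ H (X j) (X k) := fun j k hjk h =>
    hH ((hhom.definable_iff hHdef (hX j k hjk).1 hne (hX j k hjk).2).1 h)
  have hXH : ∀ j k, H (X j) (X k) → j = k := by
    intro j k h
    rcases lt_trichotomy j k with hjk | hjk | hjk
    · exact (hXH' j k hjk h).elim
    · exact hjk
    · exact (hXH' k j hjk (H.symm' h)).elim
  obtain ⟨m, hm⟩ := exists_pow_lt_two_pow n
  obtain ⟨A, D, hA, -, hDc, -, hDH, hdef⟩ :=
    hhom.exists_doubling hE hF hG hEF hEG hFG hle' hXE hXH m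
  have hcard := hhom.card_le_of_orbits A D fun d hd d' hd' hdd' ⟨σ, hσ, hσA, h⟩ =>
    hdd' (hDH d hd d' hd' (h ▸ hdef σ hσ hσA d hd))
  have : ((A.card + 1) * (A.card + 1)) ^ n ≤ ((m + 2) * (m + 2)) ^ n := by
    exact Nat.pow_le_pow_left (Nat.mul_le_mul (by omega) (by omega)) n
  omega

end Diamond

theorem Homogeneous.inf_sup_le (hhom : S.Homogeneous) {E F G : Setoid Γ}
    (hE : S.Definable E) (hF : S.Definable F) (hG : S.Definable G) :
    E ⊓ (F ⊔ G) ≤ (E ⊓ F) ⊔ (E ⊓ G) := by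
  set H := (E ⊓ F) ⊔ (E ⊓ G)
  set F' := (E ⊓ G) ⊔ F
  set G' := (E ⊓ F) ⊔ G
  set K := F' ⊓ G'
  set E' := K ⊔ (E ⊓ (F ⊔ G))
  have dEF := hE.inf hF
  have dEG := hE.inf hG
  have dF' : S.Definable F' := hhom.definable_sup dEG hF
  have dG' : S.Definable G' := hhom.definable_sup dEF hG
  have dK : S.Definable K := dF'.inf dG'
  have dE₀ : S.Definable (E ⊓ (F ⊔ G) : Setoid Γ) := hE.inf (hhom.definable_sup hF hG)
  have dE' : S.Definable E' := hhom.definable_sup dK dE₀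
  have hHK : H ≤ K := sup_le
    (le_inf (inf_le_right.trans le_sup_right) le_sup_left)
    (le_inf le_sup_left (inf_le_right.trans le_sup_right))
  have hF'E : F' ⊓ E ≤ H := (hhom.sup_inf_le dEG hF hE inf_le_left).trans
    (sup_le le_sup_right ((inf_comm F E).le.trans le_sup_left))
  have hG'E : G' ⊓ E ≤ H := (hhom.sup_inf_le dEF hG hE inf_le_left).trans
    (sup_le le_sup_left ((inf_comm G E).le.trans le_sup_right))
  have hE'F' : E' ⊓ F' = K := by
    refine le_antisymm ?_ (le_inf le_sup_left inf_le_left)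
    refine (hhom.sup_inf_le dK dE₀ dF' inf_le_left).trans (sup_le le_rfl ?_)
    exact (le_inf inf_le_right (inf_le_left.trans inf_le_left)).trans (hF'E.trans hHK)
  have hE'G' : E' ⊓ G' = K := by
    refine le_antisymm ?_ (le_inf le_sup_left inf_le_right)
    refine (hhom.sup_inf_le dK dE₀ dG' inf_le_right).trans (sup_le le_rfl ?_)
    exact (le_inf inf_le_right (inf_le_left.trans inf_le_left)).trans (hG'E.trans hHK)
  have hle : E' ≤ F' ⊔ G' := sup_le (inf_le_left.trans le_sup_left)
    (inf_le_right.trans (sup_le_sup le_sup_right le_sup_right))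
  have hEK : E' ≤ K := hhom.le_of_diamond dE' dF' dG' hE'F' hE'G' rfl hle
  exact (le_inf (le_sup_right.trans (hEK.trans inf_le_left)) inf_le_left).trans hF'E

end PermStruct

/-- The lattice of ∅-definable equivalence relations of a homogeneous `n`-dimensional
permutation structure is distributive: meet (intersection) distributes over join (transitive
closure of the union). -/
theorem lattice_of_equivalence_relations_distributive
    {n : ℕ} {Γ : Type*} [Countable Γ] [Infinite Γ] (S : PermStruct n Γ)
    (hhom : S.Homogeneous)
    (E F G : Γ → Γ → Prop)
    (hEdef : S.Definable E) (hEequiv : Equivalence E)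
    (hFdef : S.Definable F) (hFequiv : Equivalence F)
    (hGdef : S.Definable G) (hGequiv : Equivalence G) :
    ∀ x y : Γ,
      (E x y ∧ Relation.TransGen (fun u v => F u v ∨ G u v) x y) ↔
        Relation.TransGen (fun u v => (E u v ∧ F u v) ∨ (E u v ∧ G u v)) x y := by
  let E' : Setoid Γ := ⟨E, hEequiv⟩
  let F' : Setoid Γ := ⟨F, hFequiv⟩
  let G' : Setoid Γ := ⟨G, hGequiv⟩
  intro x y
  constructor
  · rintro ⟨hxy, h⟩
    have step : ∀ u v, F u v ∨ G u v → (F' ⊔ G') u v := fun u v h =>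
      h.elim (fun h => Setoid.le_def.1 (le_sup_left : F' ≤ F' ⊔ G') h)
        (fun h => Setoid.le_def.1 (le_sup_right : G' ≤ F' ⊔ G') h)
    have hFG : (F' ⊔ G') x y :=
      Relation.transGen_minimal (r' := (F' ⊔ G' : Setoid Γ)) step _ _ h
    obtain ⟨w, h₁, h₂⟩ := (hhom.sup_iff (PermStruct.Definable.inf (E := E') (F := F') hEdef hFdef)
      (PermStruct.Definable.inf (E := E') (F := G') hEdef hGdef)).1
      (Setoid.le_def.1 (hhom.inf_sup_le (E := E') (F := F') (G := G') hEdef hFdef hGdef)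
        ⟨hxy, hFG⟩)
    exact .tail (.single (.inl h₁)) (.inr h₂)
  · intro h
    constructor
    · induction h with
      | single h => exact h.elim And.left And.left
      | tail _ h ih => exact hEequiv.trans ih (h.elim And.left And.left)
    · exact Relation.TransGen.mono (fun u v => Or.imp And.right And.right) _ _ h
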